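/- Suppose [·,·] is a Lie bracket on ℝ^7 and Λ : ℝ^7 → 𝔤𝔩(7,ℝ) is a linear map with Λ(x)y − Λ(y)x = [x,y] and Λ(x) ∈ 𝔤₂* for all x,y ∈ ℝ^7. Then for each k ∈ {1,2}, the infinitesimal holonomy 𝔥 never equals ℝ·diag(1,0) ⋉ 𝔪(1,0,k), i.e. 𝔥 ≠ {h(t·diag(1,0), v, (y_1,y_2)) : t,v,y_1,y_2 ∈ ℝ} and 𝔥 ≠ {h(t·diag(1,0), v, (y_1,0)) : t,v,y_1 ∈ ℝ}. -/

import Mathlib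

open Matrix

noncomputable section

abbrev V7 : Type := Fin 7 → ℝ
abbrev M7 : Type := Matrix (Fin 7) (Fin 7) ℝ
abbrev M2 : Type := Matrix (Fin 2) (Fin 2) ℝ

/-- The standard basis of `ℝ^7` (0-indexed: `e 0` is `e_1` of the paper). -/
def e (i : Fin 7) : V7 := Pi.single i 1

/-- The matrix `X(s)` (indices shifted: `s 0 = s_1`, …, `s 13 = s_14`). -/
def Xg2 (s : Fin 14 → ℝ) : M7 :=
  !![s 0 + s 3, -s 9, s 8, Real.sqrt 2 * s 5, 0, -s 10, -s 11;
     -s 7, s 0, s 1, Real.sqrt 2 * s 8, s 10, 0, s 5;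
     s 6, s 2, s 3, Real.sqrt 2 * s 9, s 11, -s 5, 0;
     Real.sqrt 2 * s 4, Real.sqrt 2 * s 6, Real.sqrt 2 * s 7, 0,
       Real.sqrt 2 * s 5, Real.sqrt 2 * s 8, Real.sqrt 2 * s 9;
     0, s 12, s 13, Real.sqrt 2 * s 4, -s 0 - s 3, s 7, -s 6;
     -s 12, 0, -s 4, Real.sqrt 2 * s 6, s 9, -s 0, -s 2;
     -s 13, s 4, 0, Real.sqrt 2 * s 7, -s 8, -s 1, -s 3]

/-- `𝔤₂* = {X(s) : s ∈ ℝ^14}`. -/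
def g2star : Set M7 := Set.range Xg2

/-- The matrix `h(A,v,u,y)`. -/
def hmat (A : M2) (v : ℝ) (u y : Fin 2 → ℝ) : M7 :=
  !![A 0 0 + A 1 1, -u 1, u 0, Real.sqrt 2 * v, 0, -y 0, -y 1;
     0, A 0 0, A 0 1, Real.sqrt 2 * u 0, y 0, 0, v;
     0, A 1 0, A 1 1, Real.sqrt 2 * u 1, y 1, -v, 0;
     0, 0, 0, 0, Real.sqrt 2 * v, Real.sqrt 2 * u 0, Real.sqrt 2 * u 1;
     0, 0, 0, 0, -(A 0 0 + A 1 1), 0, 0;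
     0, 0, 0, 0, u 1, -A 0 0, -A 1 0;
     0, 0, 0, 0, -u 0, -A 0 1, -A 1 1]

/-- `𝔥^I = {h(A,v,u,y)}`. -/
def hI : Set M7 := {X | ∃ A v u y, X = hmat A v u y}

/-- The matrix `h(A,v,y) := h(A,v,0,y)`. -/
def h3 (A : M2) (v : ℝ) (y : Fin 2 → ℝ) : M7 := hmat A v 0 y

/-- `𝔥^III = {h(A,v,y)}`. -/
def hIII : Set M7 := {X | ∃ A v y, X = h3 A v y}

/-- `𝔪(1,0,1) = {h(0,v,(y_1,0))}`. -/
def m101 : Set M7 := {X | ∃ v y1, X = h3 0 v ![y1, 0]}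

/-- `𝔪(1,0,2) = {h(0,v,(y_1,y_2))}`. -/
def m102 : Set M7 := {X | ∃ v y, X = h3 0 v y}

/-- The curvature `R(x,y) = Λ(x)Λ(y) − Λ(y)Λ(x) − Λ([x,y])`. -/
def curv (L : V7 →ₗ[ℝ] M7) (bk : V7 → V7 → V7) (x y : V7) : M7 :=
  L x * L y - L y * L x - L (bk x y)

/-- The infinitesimal holonomy: the smallest linear subspace of `𝔤𝔩(7,ℝ)` containing
all `R(x,y)` and stable under bracketing with all `Λ(z)`. -/
def infHol (L : V7 →ₗ[ℝ] M7) (bk : V7 → V7 → V7) : Submodule ℝ M7 :=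
  sInf {H : Submodule ℝ M7 | (∀ x y, curv L bk x y ∈ H) ∧
    ∀ z : V7, ∀ X ∈ H, L z * X - X * L z ∈ H}

/-- `𝔰𝔩(2,ℝ)` as a set of 2×2 matrices. -/
def sl2 : Set M2 := {A | A 0 0 + A 1 1 = 0}

/-- `𝔤𝔩(2,ℝ)` as a set of 2×2 matrices. -/
def gl2 : Set M2 := Set.univ

/-- `𝔠𝔬(2) = {(a,−b;b,a)}`. -/
def co2 : Set M2 := {A | ∃ a b : ℝ, A = !![a, -b; b, a]}

/-- `𝔡`, the diagonal 2×2 matrices. -/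
def dd : Set M2 := {A | A 0 1 = 0 ∧ A 1 0 = 0}

/-- `ℝ·diag(1,0)`. -/
def rdiag10 : Set M2 := {A | ∃ t : ℝ, A = !![t, 0; 0, 0]}

/-- `𝔞 ⋉ 𝔪(1,0,k)`. -/
def semidir (a : Set M2) : ℕ → Set M7
  | 1 => {X | ∃ A ∈ a, ∃ v y1, X = h3 A v ![y1, 0]}
  | _ => {X | ∃ A ∈ a, ∃ v y, X = h3 A v y}

/-- The pairs `(𝔞, k)` occurring in the list of type III holonomy algebras. -/
def ListedPair (a : Set M2) (k : ℕ) : Prop :=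
  ((a = sl2 ∨ a = gl2 ∨ a = co2 ∨ a = dd) ∧ k = 2) ∨
  ((a = ({0} : Set M2) ∨ a = rdiag10) ∧ (k = 1 ∨ k = 2))

/-- The listed type III holonomy algebras `𝔞 ⋉ 𝔪(1,0,k)`. -/
def ListedTypeIII (S : Set M7) : Prop := ∃ a k, ListedPair a k ∧ S = semidir a k

/-- The normal form of `Λ(z)`: it lies in the algebra spanned by the diagonal torus and the
components `u_2, v, y_1, y_2`. -/
def normalForm (a d u v p q : ℝ) : M7 := hmat !![a, 0; 0, d] v ![0, u] ![p, q]

lemma e_apply (i j : Fin 7) : e i j = if j = i then 1 else 0 := by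
  simp [e, Pi.single_apply]

section structure_equations

variable {a d u v p q : V7 →ₗ[ℝ] ℝ} {bk : V7 → V7 → V7} {L : V7 →ₗ[ℝ] M7}

lemma bracket_coords (hform : ∀ z, L z = normalForm (a z) (d z) (u z) (v z) (p z) (q z))
    (hbk : ∀ x y : V7, (L x).mulVec y - (L y).mulVec x = bk x y) (x y : V7) :
    bk x y =
      ![(a x + d x) * y 0 - u x * y 1 + √2 * v x * y 3 - p x * y 5 - q x * y 6
          - ((a y + d y) * x 0 - u y * x 1 + √2 * v y * x 3 - p y * x 5 - q y * x 6),
        a x * y 1 + p x * y 4 + v x * y 6 - (a y * x 1 + p y * x 4 + v y * x 6),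
        d x * y 2 + √2 * u x * y 3 + q x * y 4 - v x * y 5
          - (d y * x 2 + √2 * u y * x 3 + q y * x 4 - v y * x 5),
        √2 * v x * y 4 + √2 * u x * y 6 - (√2 * v y * x 4 + √2 * u y * x 6),
        -(a x + d x) * y 4 + (a y + d y) * x 4,
        u x * y 4 - a x * y 5 - (u y * x 4 - a y * x 5),
        -d x * y 6 + d y * x 6] := by
  rw [← hbk, hform x, hform y]
  ext k
  fin_cases k <;>
    simp [normalForm, hmat, dotProduct, Fin.sum_univ_succ] <;> ring

lemma curv_entry (x y : V7) (i j : Fin 7) :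
    curv L bk x y i j = (L x * L y) i j - (L y * L x) i j - L (bk x y) i j := rfl

lemma curv_entries (hform : ∀ z, L z = normalForm (a z) (d z) (u z) (v z) (p z) (q z))
    (x y : V7) :
    curv L bk x y 1 1 = -a (bk x y) ∧ curv L bk x y 2 2 = -d (bk x y) ∧
    curv L bk x y 1 4 =
      (2 * a x + d x) * p y - (2 * a y + d y) * p x - p (bk x y) := by
  simp only [curv_entry, hform, normalForm, hmat, Matrix.mul_apply]
  simp [Fin.sum_univ_succ]
  refine ⟨by ring, by ring, by ring⟩

lemma bianchi (hbk : ∀ x y : V7, (L x).mulVec y - (L y).mulVec x = bk x y)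
    (hjac : ∀ x y z : V7, bk (bk x y) z + bk (bk y z) x + bk (bk z x) y = 0) (x y z : V7) :
    curv L bk x y *ᵥ z + curv L bk y z *ᵥ x + curv L bk z x *ᵥ y = 0 := by
  have h := hjac x y z
  rw [← hbk (bk x y) z, ← hbk (bk y z) x, ← hbk (bk z x) y] at h
  have hmul : ∀ w x y : V7, L w *ᵥ bk x y = L w *ᵥ (L x *ᵥ y) - L w *ᵥ (L y *ᵥ x) := by
    intro w x y
    rw [← hbk x y, Matrix.mulVec_sub]
  simp only [hmul] at h
  simp only [curv, Matrix.sub_mulVec, ← Matrix.mulVec_mulVec]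
  rw [← neg_eq_zero, ← h]
  abel

lemma apply_eq_sum (f : V7 →ₗ[ℝ] ℝ) (w : V7) :
    f w = w 0 * f (e 0) + w 1 * f (e 1) + w 2 * f (e 2) + w 3 * f (e 3) + w 4 * f (e 4)
      + w 5 * f (e 5) + w 6 * f (e 6) := by
  have h : w = w 0 • e 0 + w 1 • e 1 + w 2 • e 2 + w 3 • e 3 + w 4 • e 4 + w 5 • e 5
      + w 6 • e 6 := by
    ext k
    fin_cases k <;> simp [e_apply]
  conv_lhs => rw [h]
  simp only [map_add, map_smul, smul_eq_mul]

end structure_equations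

/-- Components of the algebraic Bianchi identity for a curvature with values in
`ℝ·diag(1,0) ⋉ 𝔪(1,0,2)`. -/
lemma bianchi_components {R : V7 → V7 → M7} {α ν π κ : V7 → V7 → ℝ}
    (hR : ∀ x y, R x y = h3 !![α x y, 0; 0, 0] (ν x y) ![π x y, κ x y])
    (hb : ∀ x y z, R x y *ᵥ z + R y z *ᵥ x + R z x *ᵥ y = 0) (x y z : V7) :
    (α x y * z 0 + √2 * ν x y * z 3 - π x y * z 5 - κ x y * z 6
      + (α y z * x 0 + √2 * ν y z * x 3 - π y z * x 5 - κ y z * x 6)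
      + (α z x * y 0 + √2 * ν z x * y 3 - π z x * y 5 - κ z x * y 6) = 0) ∧
    (α x y * z 1 + π x y * z 4 + ν x y * z 6 + (α y z * x 1 + π y z * x 4 + ν y z * x 6)
      + (α z x * y 1 + π z x * y 4 + ν z x * y 6) = 0) ∧
    (κ x y * z 4 - ν x y * z 5 + (κ y z * x 4 - ν y z * x 5)
      + (κ z x * y 4 - ν z x * y 5) = 0) ∧
    (ν x y * z 4 + ν y z * x 4 + ν z x * y 4 = 0) ∧
    (α x y * z 4 + α y z * x 4 + α z x * y 4 = 0) ∧
    (α x y * z 5 + α y z * x 5 + α z x * y 5 = 0) := by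
  have h := fun k => congrFun (hb x y z) k
  simp only [hR] at h
  have h0 := h 0
  have h1 := h 1
  have h2 := h 2
  have hν := h 3
  have h4 := h 4
  have h5 := h 5
  simp [h3, hmat, dotProduct, Fin.sum_univ_succ] at h0 h1 h2 hν h4 h5
  have hs : √2 ≠ 0 := by positivity
  refine ⟨by linarith, by linarith, by linarith, ?_, by linarith, by linarith⟩
  apply mul_left_cancel₀ hs
  linarith

/-- Solution of the algebraic Bianchi identity for the `α`- and `π`-components. -/
lemma solve_bianchi {R : V7 → V7 → M7} {α ν π κ : V7 → V7 → ℝ}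
    (hR : ∀ x y, R x y = h3 !![α x y, 0; 0, 0] (ν x y) ![π x y, κ x y])
    (hanti : ∀ x y, R x y = -R y x)
    (hb : ∀ x y z, R x y *ᵥ z + R y z *ᵥ x + R z x *ᵥ y = 0) :
    ∃ c m A B : ℝ, (∀ x y, α x y = c * (x 4 * y 5 - x 5 * y 4)) ∧
      ∀ x y, π x y = c * (x 1 * y 5 - x 5 * y 1) - m * (x 5 * y 6 - x 6 * y 5)
        + x 4 * (-c * y 0 - √2 * m * y 3 + A * y 5 + B * y 6)
        - y 4 * (-c * x 0 - √2 * m * x 3 + A * x 5 + B * x 6) := by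
  have hα : ∀ x y, α x y = -α y x := fun x y => by
    have := congrFun (congrFun (hanti x y) 1) 1
    simpa [hR, h3, hmat] using this
  have hν : ∀ x y, ν x y = -ν y x := fun x y => by
    have := congrFun (congrFun (hanti x y) 1) 6
    simpa [hR, h3, hmat] using this
  have hπ : ∀ x y, π x y = -π y x := fun x y => by
    have := congrFun (congrFun (hanti x y) 1) 4
    simpa [hR, h3, hmat] using this
  have hκ : ∀ x y, κ x y = -κ y x := fun x y => by
    have := congrFun (congrFun (hanti x y) 2) 4
    simpa [hR, h3, hmat] using this
  have B := fun x y z => bianchi_components hR hb x y z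
  set c := α (e 4) (e 5)
  have α4 : ∀ y, α (e 4) y = c * y 5 := by
    intro y
    have h := (B (e 4) (e 5) y).2.2.2.2.2
    simp [e_apply] at h
    linarith [hα y (e 4)]
  have αf : ∀ x y, α x y = c * (x 4 * y 5 - x 5 * y 4) := by
    intro x y
    have h := (B (e 4) x y).2.2.2.2.1
    rw [hα y (e 4), α4, α4] at h
    simp [e_apply] at h
    linarith
  have νf : ∀ x y, ν x y = x 4 * ν (e 4) y - y 4 * ν (e 4) x := by
    intro x y
    have h := (B (e 4) x y).2.2.2.1
    rw [hν y (e 4)] at h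
    simp [e_apply] at h ⊢
    linarith
  have κf : ∀ x y, κ x y = x 4 * κ (e 4) y - y 4 * κ (e 4) x
      - x 5 * ν (e 4) y + y 5 * ν (e 4) x := by
    intro x y
    have h := (B (e 4) x y).2.2.1
    rw [hν y (e 4), hκ y (e 4)] at h
    simp [e_apply] at h ⊢
    linarith
  have πf : ∀ x y, π x y = c * (x 1 * y 5 - x 5 * y 1) + x 4 * π (e 4) y - y 4 * π (e 4) x
      + x 6 * ν (e 4) y - y 6 * ν (e 4) x := by
    intro x y
    have h := (B (e 4) x y).2.1
    rw [hν y (e 4), hπ y (e 4), hα y (e 4), α4, α4] at h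
    simp [e_apply] at h ⊢
    linarith
  have ωf : ∀ y, π (e 4) y = -c * y 0 - √2 * ν (e 4) (e 5) * y 3 + π (e 4) (e 5) * y 5
      + κ (e 4) (e 5) * y 6 := by
    intro y
    have h := (B (e 4) (e 5) y).1
    rw [hν y (e 4), hπ y (e 4), hα y (e 4), hκ y (e 4), α4, α4] at h
    simp [e_apply] at h ⊢
    linarith
  have ν44 : ν (e 4) (e 4) = 0 := by linarith [hν (e 4) (e 4)]
  have μf : ∀ w, 2 * ν (e 4) w = w 4 * (π (e 4) (e 6) - κ (e 4) (e 5))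
      + w 5 * (ν (e 4) (e 5) - π (e 5) (e 6)) + w 6 * (ν (e 4) (e 6) - κ (e 5) (e 6)) := by
    intro w
    have h := (B (e 5) (e 6) w).1
    rw [νf (e 5) (e 6), αf (e 5) (e 6), πf (e 6) w, κf w (e 5)] at h
    simp [e_apply] at h ⊢
    linarith
  have μ4 := μf (e 4)
  have μ5 := μf (e 5)
  have μ6 := μf (e 6)
  have μg : ∀ w, ν (e 4) w = ν (e 4) (e 5) * w 5 + ν (e 4) (e 6) * w 6 := by
    intro w
    have h := μf w
    rw [ν44] at μ4
    simp [e_apply] at μ4 μ5 μ6 h ⊢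
    linear_combination (1 / 2) * h - w 4 / 2 * μ4 - w 5 / 2 * μ5 - w 6 / 2 * μ6
  refine ⟨c, ν (e 4) (e 5), π (e 4) (e 5), κ (e 4) (e 5), αf, fun x y => ?_⟩
  rw [πf, μg x, μg y, ωf x, ωf y]
  ring

/-- The `diag(1,0)`-component of the curvature vanishes. -/
lemma torus_component_bracket_eq_zero {a d u v p q : V7 →ₗ[ℝ] ℝ} {bk : V7 → V7 → V7}
    {L : V7 →ₗ[ℝ] M7} (hform : ∀ z, L z = normalForm (a z) (d z) (u z) (v z) (p z) (q z))
    (hbk : ∀ x y : V7, (L x).mulVec y - (L y).mulVec x = bk x y)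
    (hjac : ∀ x y z : V7, bk (bk x y) z + bk (bk y z) x + bk (bk z x) y = 0)
    (hR : ∀ x y, ∃ t v w, curv L bk x y = h3 !![t, 0; 0, 0] v w) (x y : V7) :
    a (bk x y) = 0 := by
  have hcR : ∀ x y, curv L bk x y = h3 !![curv L bk x y 1 1, 0; 0, 0] (curv L bk x y 1 6)
      ![curv L bk x y 1 4, curv L bk x y 2 4] := by
    intro x y
    obtain ⟨t, v, w, h⟩ := hR x y
    have hy : w = ![w 0, w 1] := by ext k; fin_cases k <;> rfl
    rw [h]
    conv_lhs => rw [hy]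
    simp [h3, hmat]
  have hbanti : ∀ x y, bk x y = -bk y x := fun x y => by rw [← hbk, ← hbk]; abel
  have hanti : ∀ x y, curv L bk x y = -curv L bk y x := fun x y => by
    simp only [curv, hbanti x y, map_neg]
    abel
  obtain ⟨c, m, A, B, hα, hπ⟩ := solve_bianchi hcR hanti (bianchi hbk hjac)
  have E := fun x y => curv_entries (bk := bk) hform x y
  have aL : ∀ x y, a (bk x y) = -c * (x 4 * y 5 - x 5 * y 4) := fun x y => by
    linarith [(E x y).1, hα x y]
  have dL : ∀ x y, d (bk x y) = 0 := fun x y => by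
    have h := congrFun (congrFun (hcR x y) 2) 2
    rw [(E x y).2.1] at h
    simpa [h3, hmat] using h
  have pL : ∀ x y, p (bk x y) = (2 * a x + d x) * p y - (2 * a y + d y) * p x
      - (c * (x 1 * y 5 - x 5 * y 1) - m * (x 5 * y 6 - x 6 * y 5)
        + x 4 * (-c * y 0 - √2 * m * y 3 + A * y 5 + B * y 6)
        - y 4 * (-c * x 0 - √2 * m * x 3 + A * x 5 + B * x 6)) := fun x y => by
    linarith [(E x y).2.2, hπ x y]
  by_cases hc : c = 0
  · simp [aL, hc]
  exfalso
  have b := fun x y => bracket_coords hform hbk x y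
  have b0 := fun x y => congrFun (b x y) 0
  have b1 := fun x y => congrFun (b x y) 1
  have b3 := fun x y => congrFun (b x y) 3
  have b4 := fun x y => congrFun (b x y) 4
  have b5 := fun x y => congrFun (b x y) 5
  have b6 := fun x y => congrFun (b x y) 6
  simp at b0 b1 b3 b4 b5 b6
  have jac : ∀ (f : V7 →ₗ[ℝ] ℝ) x y z,
      f (bk (bk x y) z) + f (bk (bk y z) x) + f (bk (bk z x) y) = 0 := fun f x y z => by
    rw [← map_add, ← map_add, hjac, map_zero]
  -- `2a + d` is a combination of the coordinates `4` and `5`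
  have ad : ∀ w, 2 * a w + d w
      = (2 * a (e 4) + d (e 4)) * w 4 + (2 * a (e 5) + d (e 5)) * w 5 := by
    intro w
    have h := jac a (e 4) (e 5) w
    simp [aL, b4, b5, e_apply] at h
    apply mul_left_cancel₀ hc
    linear_combination h
  generalize hX : 2 * a (e 4) + d (e 4) = X at ad
  generalize hY : 2 * a (e 5) + d (e 5) = Y at ad
  have adL : ∀ x y, X * bk x y 4 + Y * bk x y 5 = -2 * c * (x 4 * y 5 - x 5 * y 4) :=
    fun x y => by
      rw [← ad, aL, dL]
      ring
  have va : ∀ w : V7, w 4 = 0 → w 5 = 0 → a w = 0 := by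
    intro w h4 h5
    have k1 := ad w
    have k2 := adL (e 5) w
    have k3 := adL (e 4) w
    have k4 := adL (e 4) (e 5)
    simp [b4, b5, e_apply, h4, h5] at k1 k2 k3 k4
    rcases eq_or_ne Y 0 with rfl | hY0
    · have hX0 : X ≠ 0 := by
        rintro rfl
        apply hc
        linarith
      exact (mul_eq_zero.1 (show X * a w = 0 by
        linear_combination X * k1 - k3)).resolve_left hX0
    · exact k2.resolve_left hY0
  have extend : ∀ f : V7 →ₗ[ℝ] ℝ, (∀ w : V7, w 4 = 0 → w 5 = 0 → f w = 0) →
      ∀ w, f w = f (e 4) * w 4 + f (e 5) * w 5 := by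
    intro f hf w
    have h := hf (w - w 4 • e 4 - w 5 • e 5) (by simp [e_apply]) (by simp [e_apply])
    simp only [map_sub, map_smul, smul_eq_mul] at h
    linear_combination h
  have fa := extend a va
  have fd : ∀ w, d w = d (e 4) * w 4 + d (e 5) * w 5 := fun w => by
    linear_combination ad w - 2 * fa w - hX * w 4 - hY * w 5
  have vu : ∀ w : V7, w 4 = 0 → w 5 = 0 → u w = 0 := by
    intro w h4 h5
    have k1 := aL (e 4) w
    have k2 := aL (e 4) (e 5)
    have k3 := adL (e 4) w
    have ha := fa w
    have hd := fd w
    rw [fa] at k1 k2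
    simp [b4, b5, e_apply, h4, h5] at k1 k2 k3 ha hd
    simp [ha, hd] at k1 k3
    rcases k3 with hY0 | h
    · refine k1.resolve_left fun hs => hc ?_
      rw [hs] at k2 hY
      have hd5 : d (e 5) = 0 := by linarith
      rw [hd5] at k2
      linarith
    · exact h
  have fu := extend u vu
  generalize a (e 4) = r at *
  generalize a (e 5) = s at *
  generalize d (e 4) = k at *
  generalize d (e 5) = n at *
  generalize u (e 4) = u4 at *
  generalize u (e 5) = u5 at *
  have closed_d := dL (e 4) (e 5)
  have curv_a := aL (e 4) (e 5)
  rw [fd] at closed_d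
  rw [fa] at curv_a
  have j := jac p
  simp only [pL, fa, fd, b0, b1, b3, b4, b5, b6, fu] at j
  have j450 := j (e 4) (e 5) (e 0)
  have j451 := j (e 4) (e 5) (e 1)
  have j065 := j (e 0) (e 6) (e 5)
  have j165 := j (e 1) (e 6) (e 5)
  have j064 := j (e 0) (e 6) (e 4)
  have c04 := pL (e 0) (e 4)
  have c05 := pL (e 0) (e 5)
  have c15 := pL (e 1) (e 5)
  rw [apply_eq_sum p (bk _ _)] at c04 c05 c15
  simp [e_apply, b, fa, fd, fu] at closed_d curv_a j450 j451 j065 j165 j064 c04 c05 c15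
  clear j
  simp only [hc, false_or] at j065 j165 j064
  rw [j065] at c05
  rw [j064, j065] at c04
  rw [j165] at c15
  generalize p (e 0) = p0 at *
  generalize p (e 1) = p1 at *
  have hp0 : 4 * p0 = 2 * s + n := by
    apply mul_left_cancel₀ hc
    linear_combination -j450 + 2 * p0 * curv_a + p0 * closed_d
  have hp1 : 4 * p1 = -(2 * r + k) := by
    apply mul_left_cancel₀ hc
    linear_combination -j451 + 2 * p1 * curv_a + p1 * closed_d
  have h04 : p0 * (r + p1) = -c := by linear_combination c04
  have hne : p0 ≠ 0 := by
    rintro rfl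
    apply hc
    linarith
  have hs : p0 = s := by
    apply mul_left_cancel₀ hne
    linear_combination -c05
  have hn : n = 2 * s := by linarith
  subst hs hn
  have hu : u5 = r - p1 := by
    apply mul_left_cancel₀ hne
    linear_combination c15 - h04
  have hk : k = -4 * p1 - 2 * r := by linarith
  subst hu hk
  have : p1 = -r := by
    apply mul_left_cancel₀ hne
    linear_combination (-1 / 10) * closed_d
  rw [this] at h04
  apply hc
  linarith

/-- An element of `𝔤₂*` normalizing `ℝ·diag(1,0) ⋉ 𝔪(1,0,k)` has the normal form. -/
lemma normal_form_of_brackets {X : M7} (hX : X ∈ g2star)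
    (hH : ∃ t v y, X * h3 !![1, 0; 0, 0] 0 0 - h3 !![1, 0; 0, 0] 0 0 * X = h3 !![t, 0; 0, 0] v y)
    (hV : ∃ t v y, X * h3 0 1 0 - h3 0 1 0 * X = h3 !![t, 0; 0, 0] v y) :
    X = normalForm (X 1 1) (X 2 2) (X 5 4) (X 1 6) (X 1 4) (X 2 4) := by
  obtain ⟨s, rfl⟩ := hX
  obtain ⟨t, v, y, h⟩ := hH
  obtain ⟨b, w, x, g⟩ := hV
  have E := fun i j => congrFun (congrFun h i) j
  have F := fun i j => congrFun (congrFun g i) j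
  have hs : √2 ≠ 0 := by positivity
  simp only [Matrix.sub_apply, Matrix.mul_apply, Xg2, h3, hmat] at E F
  have z1 := E 1 2
  have z2 := E 2 1
  have z8 := E 0 2
  have z4 := E 3 0
  have z6 := E 2 0
  have z12 := E 4 1
  have z13 := E 4 2
  have z7 := F 3 5
  simp [Fin.sum_univ_succ] at z1 z2 z8 z4 z6 z12 z13 z7
  replace z7 : s 7 = 0 := by
    apply mul_left_cancel₀ hs
    linarith
  clear E F h g
  ext i j
  fin_cases i <;> fin_cases j <;>
    simp [Xg2, normalForm, hmat, z1, z2, z8, z4, z6, z12, z13, z7, sub_eq_add_neg, add_comm]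

/-- The infinitesimal holonomy contains the curvature. -/
lemma curv_mem_infHol (L : V7 →ₗ[ℝ] M7) (bk : V7 → V7 → V7) (x y : V7) :
    curv L bk x y ∈ infHol L bk := by
  rw [infHol, Submodule.mem_sInf]
  exact fun H hH => hH.1 x y

/-- The infinitesimal holonomy is stable under bracketing with `Λ(z)`. -/
lemma bracket_mem_infHol {L : V7 →ₗ[ℝ] M7} {bk : V7 → V7 → V7} (z : V7) {X : M7}
    (hX : X ∈ infHol L bk) : L z * X - X * L z ∈ infHol L bk := by
  rw [infHol, Submodule.mem_sInf] at hX ⊢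
  exact fun H hH => hH.2 z X (hX H hH)

/-- The infinitesimal holonomy cannot lie in `ℝ·diag(1,0) ⋉ 𝔪(1,0,2)` and contain `h(diag(1,0),0,0)`
and `h(0,1,0)`. -/
lemma not_infHol_between {bk : V7 → V7 → V7} {L : V7 →ₗ[ℝ] M7}
    (hbk : ∀ x y : V7, (L x).mulVec y - (L y).mulVec x = bk x y)
    (hjac : ∀ x y z : V7, bk (bk x y) z + bk (bk y z) x + bk (bk z x) y = 0)
    (hL : ∀ x, L x ∈ g2star)
    (hle : ∀ X ∈ infHol L bk, ∃ t v y, X = h3 !![t, 0; 0, 0] v y)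
    (hH : h3 !![1, 0; 0, 0] 0 0 ∈ infHol L bk) (hV : h3 0 1 0 ∈ infHol L bk) : False := by
  let E (i j : Fin 7) : V7 →ₗ[ℝ] ℝ := Matrix.entryLinearMap ℝ ℝ i j ∘ₗ L
  have hform : ∀ z, L z = normalForm (E 1 1 z) (E 2 2 z) (E 5 4 z) (E 1 6 z) (E 1 4 z)
      (E 2 4 z) := fun z =>
    normal_form_of_brackets (hL z) (hle _ (bracket_mem_infHol z hH))
      (hle _ (bracket_mem_infHol z hV))
  have ha := torus_component_bracket_eq_zero hform hbk hjac
    fun x y => hle _ (curv_mem_infHol L bk x y)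
  let K : Submodule ℝ M7 := infHol L bk ⊓ LinearMap.ker (Matrix.entryLinearMap ℝ ℝ 1 1)
  have hK : infHol L bk ≤ K := by
    refine sInf_le ⟨fun x y => ⟨curv_mem_infHol L bk x y, ?_⟩,
      fun z X hX => ⟨bracket_mem_infHol z hX.1, ?_⟩⟩
    · simp [(curv_entries hform x y).1, ha]
    · obtain ⟨t, v, y, rfl⟩ := hle X hX.1
      rw [hform z]
      simp [normalForm, h3, hmat, mul_comm]
  simpa [h3, hmat] using (hK hH).2

theorem stmt13 (bk : V7 → V7 → V7) (L : V7 →ₗ[ℝ] M7)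
    (hbk : ∀ x y : V7, (L x).mulVec y - (L y).mulVec x = bk x y)
    (halt : ∀ x : V7, bk x x = 0)
    (hjac : ∀ x y z : V7, bk (bk x y) z + bk (bk y z) x + bk (bk z x) y = 0)
    (hL : ∀ x, L x ∈ g2star) :
    (infHol L bk : Set M7) ≠ semidir rdiag10 2 ∧
    (infHol L bk : Set M7) ≠ semidir rdiag10 1 := by
  have h0 : ![0, 0] = (0 : Fin 2 → ℝ) := by ext k; fin_cases k <;> rfl
  constructor <;> intro h <;> refine not_infHol_between hbk hjac hL (fun X hX => ?_) ?_ ?_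
  · obtain ⟨A, ⟨t, rfl⟩, v, y, rfl⟩ := h.subset hX
    exact ⟨t, v, y, rfl⟩
  · exact h.superset ⟨_, ⟨1, rfl⟩, 0, 0, rfl⟩
  · exact h.superset ⟨0, ⟨0, by ext i j; fin_cases i <;> fin_cases j <;> rfl⟩, 1, 0, rfl⟩
  · obtain ⟨A, ⟨t, rfl⟩, v, y, rfl⟩ := h.subset hX
    exact ⟨t, v, _, rfl⟩
  · exact h.superset ⟨_, ⟨1, rfl⟩, 0, 0, by rw [h0]⟩
  · exact h.superset ⟨0, ⟨0, by ext i j; fin_cases i <;> fin_cases j <;> rfl⟩, 1, 0, by rw [h0]⟩
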